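/- Fix an integer p ≥ 3 and let λ = 2cos(π/p). Let α be a hyperbolic fixed point of the Hecke group G_p with Hecke conjugate α'. Then α' < 0 < α (α is G_p-simple) if and only if there exist a G_p-reduced number β and an integer i with 1 ≤ i ≤ ⌊β/λ⌋ such that α = β − iλ. -/

import Mathlib

open Real Matrix Filter

noncomputable section

/-- `λ_p = 2 cos (π / p)`, the minimal translation length of the Hecke group `G_p`. -/
def heckeLambda (p : ℕ) : ℝ := 2 * Real.cos (Real.pi / p)

/-- The matrix `S = [[1, λ], [0, 1]]`. -/
def Smat (l : ℝ) : Matrix (Fin 2) (Fin 2) ℝ := !![1, l; 0, 1]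

/-- The matrix `T = [[0, -1], [1, 0]]`. -/
def Tmat : Matrix (Fin 2) (Fin 2) ℝ := !![0, -1; 1, 0]

/-- The matrix `U = S * T = [[λ, -1], [1, 0]]`. -/
def Umat (l : ℝ) : Matrix (Fin 2) (Fin 2) ℝ := !![l, -1; 1, 0]

/-- The matrix `S^r = [[1, rλ], [0, 1]]` for an integer exponent `r`. -/
def SmatZ (l : ℝ) (r : ℤ) : Matrix (Fin 2) (Fin 2) ℝ := !![1, (r : ℝ) * l; 0, 1]

/-- Möbius (linear fractional) action of a `2 × 2` real matrix on a real number. -/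
def mobius (M : Matrix (Fin 2) (Fin 2) ℝ) (x : ℝ) : ℝ :=
  (M 0 0 * x + M 0 1) / (M 1 0 * x + M 1 1)

/-- `U^k(0)`, the image of `0` under `k` iterations of the linear fractional
transformation `U : x ↦ λ - 1/x`; as a ratio of entries of the matrix power `U^k`. -/
def Uorbit (l : ℝ) (k : ℕ) : ℝ := ((Umat l) ^ k) 0 1 / ((Umat l) ^ k) 1 1

/-- The complete quotients `α_j` of the (negative) `λ`-continued fraction algorithm:
`α_0 = α`, `α_{j+1} = 1 / (r_j λ - α_j)` with `r_j = ⌊α_j / λ⌋ + 1`. -/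
def cq (l α : ℝ) : ℕ → ℝ
  | 0 => α
  | j + 1 => 1 / (((⌊cq l α j / l⌋ : ℝ) + 1) * l - cq l α j)

/-- The partial quotients `r_j = ⌊α_j / λ⌋ + 1` of the `λ`-continued fraction of `α`. -/
def pq (l α : ℝ) (j : ℕ) : ℤ := ⌊cq l α j / l⌋ + 1

/-- `S` as an element of `SL(2, ℝ)`. -/
def Sgen (l : ℝ) : Matrix.SpecialLinearGroup (Fin 2) ℝ :=
  ⟨!![1, l; 0, 1], by norm_num [Matrix.det_fin_two_of]⟩

/-- `T` as an element of `SL(2, ℝ)`. -/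
def Tgen : Matrix.SpecialLinearGroup (Fin 2) ℝ :=
  ⟨!![0, -1; 1, 0], by norm_num [Matrix.det_fin_two_of]⟩

/-- The Hecke group `G_p`, the subgroup of `SL(2, ℝ)` generated by `S` and `T`. -/
def heckeGroup (l : ℝ) : Subgroup (Matrix.SpecialLinearGroup (Fin 2) ℝ) :=
  Subgroup.closure {Sgen l, Tgen}

/-- `M = [[a, b], [c, d]]` fixes `α` as a linear fractional transformation, i.e.
`α` is a root of `c x² + (d - a) x - b = 0`. -/
def fixesQuad (M : Matrix.SpecialLinearGroup (Fin 2) ℝ) (α : ℝ) : Prop :=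
  M.1 1 0 * α ^ 2 + (M.1 1 1 - M.1 0 0) * α - M.1 0 1 = 0

/-- `α` is a hyperbolic fixed point of the Hecke group `G(λ)`. -/
def IsHypFixedPt (l α : ℝ) : Prop :=
  ∃ M ∈ heckeGroup l, 2 < |M.1 0 0 + M.1 1 1| ∧ fixesQuad M α

/-- `α` is a hyperbolic fixed point of `G(λ)` with Hecke conjugate `α'`
(the other root of the fixed-point quadratic). -/
def IsHypPair (l α α' : ℝ) : Prop :=
  ∃ M ∈ heckeGroup l, 2 < |M.1 0 0 + M.1 1 1| ∧ fixesQuad M α ∧ fixesQuad M α' ∧ α' ≠ α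

/-- A hyperbolic fixed point is `G_p`-reduced when its complete-quotient sequence is
purely periodic. -/
def GpReduced (l β : ℝ) : Prop :=
  IsHypFixedPt l β ∧ ∃ m, 1 ≤ m ∧ cq l β m = β

/-- The map `Φ_p : [0, ∞) → [0, ∞)`: `Φ_p(x) = T U^i (x)` when
`U^{p-i+1}(0) ≤ x < U^{p-i}(0)` for the (unique) `i` with `1 ≤ i ≤ p - 2`,
and `Φ_p(x) = x - λ` when `x ≥ λ`. -/
def Phi (p : ℕ) (l : ℝ) (x : ℝ) : ℝ :=
  @dite ℝ (∃ i : ℕ, 1 ≤ i ∧ i ≤ p - 2 ∧ Uorbit l (p - i + 1) ≤ x ∧ x < Uorbit l (p - i))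
    (Classical.propDecidable _)
    (fun h => mobius (Tmat * (Umat l) ^ h.choose) x)
    (fun _ => x - l)

/-- `C_{n-j, n}`: the partial convergents computed by downward recursion,
`C_{n,n} = r_n λ` and `C_{m,n} = r_m λ - 1 / C_{m+1,n}`. -/
def convAux (l α : ℝ) (n : ℕ) : ℕ → ℝ
  | 0 => (pq l α n : ℝ) * l
  | j + 1 => (pq l α (n - (j + 1)) : ℝ) * l - 1 / convAux l α n j

/-- The `n`-th convergent `C_n = C_{0,n}` of the `λ`-continued fraction of `α`. -/
def conv (l α : ℝ) (n : ℕ) : ℝ := convAux l α n n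

/-- The word `S^{r_0} T S^{r_1} T ⋯ S^{r_n} T`. -/
def cfWord (l : ℝ) (r : ℕ → ℤ) (n : ℕ) : Matrix (Fin 2) (Fin 2) ℝ :=
  ((List.range (n + 1)).map fun j => SmatZ l (r j) * Tmat).prod

/-- `sin (kπ/p) / sin (π/p)`, the Chebyshev-type sequence of entries of the powers of `U`. -/
def sinRatio (p : ℕ) (k : ℤ) : ℝ := Real.sin (k * (Real.pi / p)) / Real.sin (Real.pi / p)

/-- The nonnegative matrix `-U^k T`, for `1 ≤ k ≤ p - 1`. -/
def block (p : ℕ) (k : ℤ) : Matrix (Fin 2) (Fin 2) ℝ :=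
  !![sinRatio p k, sinRatio p (k + 1); sinRatio p (k - 1), sinRatio p k]

/-- The product of the blocks indexed by a list. -/
def blockWord (p : ℕ) (w : List ℤ) : Matrix (Fin 2) (Fin 2) ℝ := (w.map (block p)).prod

/-- All indices of the list lie in `[1, p - 1]`. -/
def Admissible (p : ℕ) (w : List ℤ) : Prop := ∀ k ∈ w, 1 ≤ k ∧ k < p

/-- `A` sends `x` to `y` as a linear fractional transformation, without degeneracy. -/
def Sends (A : Matrix (Fin 2) (Fin 2) ℝ) (x y : ℝ) : Prop :=
  A 0 0 * x + A 0 1 = y * (A 1 0 * x + A 1 1) ∧ A 1 0 * x + A 1 1 ≠ 0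

/-- The fixed-point quadratic of a matrix. -/
def fixQuad (A : Matrix (Fin 2) (Fin 2) ℝ) (x : ℝ) : ℝ :=
  A 1 0 * x ^ 2 + (A 1 1 - A 0 0) * x - A 0 1

/-- Entrywise nonnegative, with diagonal entries at least one. -/
structure DiagPos (A : Matrix (Fin 2) (Fin 2) ℝ) : Prop where
  a : 1 ≤ A 0 0
  b : 0 ≤ A 0 1
  c : 0 ≤ A 1 0
  d : 1 ≤ A 1 1

section Sequence

variable {p : ℕ}

lemma sin_pi_div_pos (hp : 3 ≤ p) : 0 < Real.sin (Real.pi / p) := by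
  have h3 : (3 : ℝ) ≤ p := by exact_mod_cast hp
  apply Real.sin_pos_of_pos_of_lt_pi
  · positivity
  · rw [div_lt_iff₀ (by linarith)]
    nlinarith [Real.pi_pos]

lemma sinRatio_zero : sinRatio p 0 = 0 := by simp [sinRatio]

lemma sinRatio_one (hp : 3 ≤ p) : sinRatio p 1 = 1 := by
  simp [sinRatio, (sin_pi_div_pos hp).ne']

lemma sinRatio_neg (k : ℤ) : sinRatio p (-k) = -sinRatio p k := by
  simp [sinRatio, neg_div]

lemma sinRatio_add_period (hp : 3 ≤ p) (k : ℤ) : sinRatio p (k + p) = -sinRatio p k := by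
  have h3 : (p : ℝ) ≠ 0 := by positivity
  have : ((k + p : ℤ) : ℝ) * (Real.pi / p) = k * (Real.pi / p) + Real.pi := by
    push_cast; field_simp
  rw [sinRatio, this, Real.sin_add_pi, neg_div, sinRatio]

lemma sinRatio_period_sub (hp : 3 ≤ p) (k : ℤ) : sinRatio p (p - k) = sinRatio p k := by
  rw [show (p : ℤ) - k = -k + p by ring, sinRatio_add_period hp, sinRatio_neg, neg_neg]

lemma sinRatio_mul (hp : 3 ≤ p) (k j : ℤ) :
    sinRatio p (k + 1) * sinRatio p j - sinRatio p k * sinRatio p (j - 1) =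
      sinRatio p (k + j) := by
  have h := (sin_pi_div_pos hp).ne'
  simp only [sinRatio]
  push_cast
  rw [add_mul, add_mul, sub_mul, one_mul, Real.sin_add, Real.sin_add, Real.sin_sub]
  field_simp
  ring

lemma sinRatio_two (hp : 3 ≤ p) : sinRatio p 2 = heckeLambda p := by
  have h := (sin_pi_div_pos hp).ne'
  simp only [sinRatio, heckeLambda]
  push_cast
  rw [Real.sin_two_mul]
  field_simp

lemma sinRatio_rec (hp : 3 ≤ p) (k : ℤ) :
    sinRatio p (k + 1) = heckeLambda p * sinRatio p k - sinRatio p (k - 1) := by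
  have := sinRatio_mul hp (k - 1) 2
  rw [sinRatio_two hp, show (2 : ℤ) - 1 = 1 by norm_num, sinRatio_one hp,
    show k - 1 + 1 = k by ring, show k - 1 + 2 = k + 1 by ring] at this
  linarith

lemma sinRatio_sq (hp : 3 ≤ p) (k : ℤ) :
    sinRatio p k * sinRatio p k - sinRatio p (k + 1) * sinRatio p (k - 1) = 1 := by
  have := sinRatio_mul hp k (1 - k)
  rw [show (1 : ℤ) - k - 1 = -k by ring, show (1 : ℤ) - k = -(k - 1) by ring, sinRatio_neg,
    sinRatio_neg, show k + -(k - 1) = 1 by ring, sinRatio_one hp] at this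
  linarith

lemma sinRatio_nonneg (hp : 3 ≤ p) {k : ℤ} (h0 : 0 ≤ k) (h1 : k ≤ p) : 0 ≤ sinRatio p k := by
  have h3 : (0 : ℝ) < p := by positivity
  have h0' : (0 : ℝ) ≤ k := by exact_mod_cast h0
  have h1' : (k : ℝ) ≤ p := by exact_mod_cast h1
  refine div_nonneg (Real.sin_nonneg_of_nonneg_of_le_pi (by positivity) ?_)
    (sin_pi_div_pos hp).le
  rw [← mul_div_assoc, div_le_iff₀ h3]
  nlinarith [Real.pi_pos]

lemma one_le_sinRatio (hp : 3 ≤ p) {k : ℤ} (h0 : 1 ≤ k) (h1 : k < p) : 1 ≤ sinRatio p k := by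
  have h := sinRatio_sq hp k
  have h2 := sinRatio_nonneg hp (k := k + 1) (by lia) (by lia)
  have h3 := sinRatio_nonneg hp (k := k - 1) (by lia) (by lia)
  have h4 := sinRatio_nonneg hp (k := k) (by lia) (by lia)
  nlinarith [mul_nonneg h2 h3]

lemma one_le_heckeLambda (hp : 3 ≤ p) : 1 ≤ heckeLambda p := by
  rw [← sinRatio_two hp]
  exact one_le_sinRatio hp (by norm_num) (by lia)

end Sequence

section Blocks

variable {p : ℕ}

lemma Tmat_mul_self : Tmat * Tmat = -1 := by
  ext i j
  fin_cases i <;> fin_cases j <;> simp [Tmat]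

lemma Tmat_mul_apply_zero (A : Matrix (Fin 2) (Fin 2) ℝ) (j : Fin 2) :
    (Tmat * A) 0 j = -A 1 j := by simp [Tmat, Matrix.mul_apply, Fin.sum_univ_two, -Matrix.cons_mul]

lemma Tmat_mul_apply_one (A : Matrix (Fin 2) (Fin 2) ℝ) (j : Fin 2) :
    (Tmat * A) 1 j = A 0 j := by simp [Tmat, Matrix.mul_apply, Fin.sum_univ_two, -Matrix.cons_mul]

lemma mul_Tmat_apply_zero (A : Matrix (Fin 2) (Fin 2) ℝ) (i : Fin 2) :
    (A * Tmat) i 0 = A i 1 := by simp [Tmat, Matrix.mul_apply, Fin.sum_univ_two]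

lemma mul_Tmat_apply_one (A : Matrix (Fin 2) (Fin 2) ℝ) (i : Fin 2) :
    (A * Tmat) i 1 = -A i 0 := by simp [Tmat, Matrix.mul_apply, Fin.sum_univ_two]

lemma block_one (hp : 3 ≤ p) : block p 1 = Smat (heckeLambda p) := by
  simp [block, Smat, sinRatio_zero, sinRatio_one hp, ← sinRatio_two hp]

lemma block_zero (hp : 3 ≤ p) : block p 0 = -Tmat := by
  ext i j
  fin_cases i <;> fin_cases j <;> simp [block, Tmat, sinRatio_zero, sinRatio_one hp, sinRatio_neg]

lemma block_add_period (hp : 3 ≤ p) (k : ℤ) : block p (k + p) = -block p k := by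
  have h1 : k + p + 1 = (k + 1) + p := by ring
  have h2 : k + p - 1 = (k - 1) + p := by ring
  ext i j
  fin_cases i <;> fin_cases j <;> simp [block, h1, h2, sinRatio_add_period hp]

lemma block_period (hp : 3 ≤ p) : block p p = Tmat := by
  have := block_add_period hp 0
  rw [block_zero hp] at this
  simpa using this

lemma block_mul_block (hp : 3 ≤ p) (k j : ℤ) :
    block p k * Tmat * block p j = block p (k + j) := by
  have h1 := sinRatio_mul hp k j
  have h2 := sinRatio_mul hp k (j + 1)
  have h3 := sinRatio_mul hp (k - 1) j
  have h4 := sinRatio_mul hp (k - 1) (j + 1)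
  simp only [add_sub_cancel_right, sub_add_cancel] at h2 h3 h4
  rw [← add_assoc] at h2
  rw [show k - 1 + (j + 1) = k + j by ring] at h4
  rw [show k - 1 + j = k + j - 1 by ring] at h3
  ext a b
  fin_cases a <;> fin_cases b <;>
    simp [block, Tmat, Matrix.mul_apply, Fin.sum_univ_two] <;> linarith

lemma block_transpose (hp : 3 ≤ p) (k : ℤ) : (block p k)ᵀ = block p (p - k) := by
  have h1 : (p : ℤ) - k + 1 = p - (k - 1) := by ring
  have h2 : (p : ℤ) - k - 1 = p - (k + 1) := by ring
  ext i j
  fin_cases i <;> fin_cases j <;> simp [block, h1, h2, sinRatio_period_sub hp]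

lemma det_block (hp : 3 ≤ p) (k : ℤ) : (block p k).det = 1 := by
  rw [block, Matrix.det_fin_two_of]
  exact sinRatio_sq hp k

lemma DiagPos.one : DiagPos 1 := ⟨by simp, by simp, by simp, by simp⟩

lemma DiagPos.mul {A B : Matrix (Fin 2) (Fin 2) ℝ} (hA : DiagPos A) (hB : DiagPos B) :
    DiagPos (A * B) := by
  obtain ⟨a, b, c, d⟩ := hA
  obtain ⟨a', b', c', d'⟩ := hB
  constructor <;> simp only [Matrix.mul_apply, Fin.sum_univ_two] <;>
    nlinarith [mul_nonneg b c', mul_nonneg c b']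

lemma DiagPos.block (hp : 3 ≤ p) {k : ℤ} (h0 : 1 ≤ k) (h1 : k < p) : DiagPos (block p k) := by
  have h := one_le_sinRatio hp h0 h1
  refine ⟨h, ?_, ?_, h⟩
  · exact sinRatio_nonneg hp (by lia) (by lia)
  · exact sinRatio_nonneg hp (by lia) (by lia)

@[simp] lemma blockWord_nil : blockWord p [] = 1 := rfl

@[simp] lemma blockWord_cons (k : ℤ) (w : List ℤ) :
    blockWord p (k :: w) = block p k * blockWord p w := by simp [blockWord]

@[simp] lemma blockWord_append (v w : List ℤ) :
    blockWord p (v ++ w) = blockWord p v * blockWord p w := by simp [blockWord]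

lemma blockWord_flatten_replicate (n : ℕ) (w : List ℤ) :
    blockWord p (List.replicate n w).flatten = blockWord p w ^ n := by
  induction n with
  | zero => simp
  | succ n ih => simp [List.replicate_succ, ih, pow_succ']

lemma blockWord_replicate_one (hp : 3 ≤ p) (n : ℕ) :
    blockWord p (List.replicate n 1) = SmatZ (heckeLambda p) n := by
  induction n with
  | zero => ext i j; fin_cases i <;> fin_cases j <;> simp [SmatZ]
  | succ n ih =>
    rw [List.replicate_succ, blockWord_cons, ih, block_one hp]
    ext i j
    fin_cases i <;> fin_cases j <;> simp [SmatZ, Smat, Matrix.mul_apply, Fin.sum_univ_two]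
    ring

lemma Admissible.nil : Admissible p [] := by simp [Admissible]

lemma admissible_append {v w : List ℤ} :
    Admissible p (v ++ w) ↔ Admissible p v ∧ Admissible p w :=
  List.forall_mem_append

lemma admissible_cons {k : ℤ} {w : List ℤ} :
    Admissible p (k :: w) ↔ (1 ≤ k ∧ k < p) ∧ Admissible p w := by
  simp [Admissible]

lemma Admissible.replicate_one (hp : 3 ≤ p) (n : ℕ) : Admissible p (List.replicate n 1) := by
  intro k hk
  rw [List.eq_of_mem_replicate hk]
  lia

lemma Admissible.flatten_replicate {w : List ℤ} (hw : Admissible p w) (n : ℕ) :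
    Admissible p (List.replicate n w).flatten := by
  intro k hk
  obtain ⟨l, hl, hk⟩ := List.mem_flatten.1 hk
  rw [List.eq_of_mem_replicate hl] at hk
  exact hw k hk

lemma DiagPos.blockWord (hp : 3 ≤ p) {w : List ℤ} (hw : Admissible p w) :
    DiagPos (blockWord p w) := by
  induction w with
  | nil => exact DiagPos.one
  | cons k w ih =>
    rw [admissible_cons] at hw
    rw [blockWord_cons]
    exact (DiagPos.block hp hw.1.1 hw.1.2).mul (ih hw.2)

lemma det_blockWord (hp : 3 ≤ p) (w : List ℤ) : (blockWord p w).det = 1 := by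
  induction w with
  | nil => simp
  | cons k w ih => rw [blockWord_cons, Matrix.det_mul, det_block hp, ih, one_mul]

lemma exists_blockWord_transpose (hp : 3 ≤ p) {w : List ℤ} (hw : Admissible p w) :
    ∃ v, Admissible p v ∧ (blockWord p w)ᵀ = blockWord p v := by
  induction w with
  | nil => exact ⟨[], hw, by simp⟩
  | cons k w ih =>
    rw [admissible_cons] at hw
    obtain ⟨v, hv, h⟩ := ih hw.2
    refine ⟨v ++ [p - k], ?_, ?_⟩
    · simp only [admissible_append, admissible_cons]
      exact ⟨hv, by lia, Admissible.nil⟩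
    · simp [Matrix.transpose_mul, h, block_transpose hp]

lemma blockWord_offDiag_pos (hp : 3 ≤ p) {w : List ℤ} (hw : Admissible p w) (hne : w ≠ []) :
    0 < blockWord p w 0 1 + blockWord p w 1 0 := by
  obtain ⟨k, w, rfl⟩ := List.exists_cons_of_ne_nil hne
  rw [admissible_cons] at hw
  obtain ⟨a, b, c, d⟩ := DiagPos.blockWord hp hw.2
  have hk := DiagPos.block hp hw.1.1 hw.1.2
  have h1 : 0 < block p k 0 1 + block p k 1 0 := by
    have := sinRatio_rec hp k
    have h2 := one_le_sinRatio hp hw.1.1 hw.1.2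
    have h3 := one_le_heckeLambda hp
    simp only [block, Matrix.of_apply, Matrix.cons_val', Matrix.cons_val_zero,
      Matrix.cons_val_one, Matrix.cons_val_fin_one]
    nlinarith
  obtain ⟨a', b', c', d'⟩ := hk
  rw [blockWord_cons]
  simp only [Matrix.mul_apply, Fin.sum_univ_two]
  nlinarith

/-- A nontrivial block word with a positive fixed point has positive off-diagonal entries. -/
lemma blockWord_pos_of_fixQuad (hp : 3 ≤ p) {w : List ℤ} (hw : Admissible p w) (hne : w ≠ [])
    {x : ℝ} (hx : 0 < x) (h : fixQuad (blockWord p w) x = 0) :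
    0 < blockWord p w 0 1 ∧ 0 < blockWord p w 1 0 := by
  obtain ⟨a, b, c, d⟩ := DiagPos.blockWord hp hw
  have hs := blockWord_offDiag_pos hp hw hne
  have hdet := det_blockWord hp w
  rw [Matrix.det_fin_two] at hdet
  unfold fixQuad at h
  have key : blockWord p w 0 1 * blockWord p w 1 0 = 0 →
      blockWord p w 0 0 = 1 ∧ blockWord p w 1 1 = 1 := by
    intro h0
    constructor <;> nlinarith
  rcases b.eq_or_lt with hb | hb
  · obtain ⟨h1, h2⟩ := key (by rw [← hb]; ring)
    rw [h1, h2, ← hb] at h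
    rw [← hb] at hs
    have : 0 < blockWord p w 1 0 * x ^ 2 := by nlinarith [pow_pos hx 2, mul_pos hs (pow_pos hx 2)]
    linarith
  · rcases c.eq_or_lt with hc | hc
    · obtain ⟨h1, h2⟩ := key (by rw [← hc]; ring)
      rw [h1, h2, ← hc] at h
      linarith
    · exact ⟨hb, hc⟩

end Blocks

section Sends

variable {A B : Matrix (Fin 2) (Fin 2) ℝ} {x y z : ℝ}

lemma Sends.mul (hB : Sends B x y) (hA : Sends A y z) : Sends (A * B) x z := by
  obtain ⟨h1, h2⟩ := hB
  obtain ⟨h3, h4⟩ := hA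
  simp only [Sends, Matrix.mul_apply, Fin.sum_univ_two]
  have h5 : (A 1 0 * B 0 0 + A 1 1 * B 1 0) * x + (A 1 0 * B 0 1 + A 1 1 * B 1 1) =
      (A 1 0 * y + A 1 1) * (B 1 0 * x + B 1 1) := by linear_combination A 1 0 * h1
  rw [h5]
  refine ⟨?_, mul_ne_zero h4 h2⟩
  linear_combination A 0 0 * h1 + (B 1 0 * x + B 1 1) * h3

lemma Sends.of_mul (hB : Sends B x y) (h : Sends (A * B) x z) : Sends A y z := by
  obtain ⟨h1, h2⟩ := hB
  obtain ⟨h3, h4⟩ := h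
  simp only [Matrix.mul_apply, Fin.sum_univ_two] at h3 h4
  have h5 : (A 1 0 * B 0 0 + A 1 1 * B 1 0) * x + (A 1 0 * B 0 1 + A 1 1 * B 1 1) =
      (A 1 0 * y + A 1 1) * (B 1 0 * x + B 1 1) := by linear_combination A 1 0 * h1
  rw [h5] at h3 h4
  refine ⟨?_, left_ne_zero_of_mul h4⟩
  apply mul_right_cancel₀ h2
  linear_combination h3 - A 0 0 * h1

lemma Sends.right_unique (h : Sends A x y) (h' : Sends A x z) : y = z :=
  mul_right_cancel₀ h.2 (h.1.symm.trans h'.1)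

lemma Sends.left_unique (hA : A.det = 1) (h : Sends A x z) (h' : Sends A y z) : x = y := by
  obtain ⟨h1, h2⟩ := h
  obtain ⟨h3, h4⟩ := h'
  rw [Matrix.det_fin_two] at hA
  have h5 : (A 0 0 - z * A 1 0) * (x - y) = 0 := by linear_combination h1 - h3
  rcases mul_eq_zero.1 h5 with h | h
  · exfalso
    have h6 : A 0 1 = z * A 1 1 := by linear_combination h1 - x * h
    have : (0 : ℝ) = 1 := by linear_combination hA - A 1 1 * h + A 1 0 * h6
    linarith
  · linarith

lemma Sends.fixQuad_eq_zero (h : Sends A x x) : fixQuad A x = 0 := by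
  unfold fixQuad
  linear_combination -h.1

lemma sends_of_fixQuad (hA : A.det = 1) (h : fixQuad A x = 0) : Sends A x x := by
  unfold fixQuad at h
  rw [Matrix.det_fin_two] at hA
  refine ⟨by linear_combination -h, fun h0 => ?_⟩
  have h1 : A 0 0 * x + A 0 1 = 0 := by linear_combination -h + x * h0
  have : (0 : ℝ) = 1 := by
    by_cases hx : A 1 0 = 0
    · rw [hx] at h0 hA
      linear_combination hA - A 0 0 * h0
    · apply mul_left_cancel₀ hx
      linear_combination A 1 0 * hA - A 1 0 * A 0 0 * h0 + A 1 0 * A 1 0 * h1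
  linarith

lemma fixQuad_smul (c : ℝ) : fixQuad (c • A) x = c * fixQuad A x := by
  simp only [fixQuad, Matrix.smul_apply, smul_eq_mul]
  ring

lemma sends_smul {c : ℝ} (hc : c ≠ 0) : Sends (c • A) x y ↔ Sends A x y := by
  simp only [Sends, Matrix.smul_apply, smul_eq_mul]
  rw [show c * A 1 0 * x + c * A 1 1 = c * (A 1 0 * x + A 1 1) by ring]
  refine and_congr ⟨fun h => mul_left_cancel₀ hc (by linear_combination h),
    fun h => by linear_combination c * h⟩ (by simp [hc])

lemma DiagPos.den_pos (hA : DiagPos A) (hx : 0 < x) : 0 < A 1 0 * x + A 1 1 := by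
  have := mul_nonneg hA.c hx.le
  have := hA.d
  linarith

lemma DiagPos.exists_sends (hA : DiagPos A) (hx : 0 < x) : ∃ y, 0 < y ∧ Sends A x y := by
  have h1 := hA.den_pos hx
  have h2 : 0 < A 0 0 * x + A 0 1 := by
    have h3 := hA.a
    have h4 := hA.b
    nlinarith
  exact ⟨_, div_pos h2 h1, (div_mul_cancel₀ _ h1.ne').symm, h1.ne'⟩

lemma DiagPos.pos_of_sends (hA : DiagPos A) (hx : 0 < x) (h : Sends A x y) : 0 < y := by
  obtain ⟨z, hz, h'⟩ := hA.exists_sends hx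
  rwa [h.right_unique h']

lemma sends_Tmat (hx : x ≠ 0) : Sends Tmat x (-1 / x) := by
  refine ⟨?_, by simpa [Tmat] using hx⟩
  simp [Tmat]
  field_simp

lemma DiagPos.not_sends_Tmat_mul (hA : DiagPos A) (hx : 0 < x) (hy : 0 < y) :
    ¬ Sends (Tmat * A) x y := by
  intro h
  obtain ⟨z, hz, hA'⟩ := hA.exists_sends hx
  have h2 := (hA'.of_mul h).right_unique (sends_Tmat hz.ne')
  have : -1 / z < 0 := div_neg_of_neg_of_pos (by norm_num) hz
  linarith

/-- By Cayley–Hamilton, powers of a `2 × 2` matrix have proportional fixed-point quadratics. -/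
lemma exists_pow_proportional (A : Matrix (Fin 2) (Fin 2) ℝ) (n : ℕ) :
    ∃ u : ℝ, (A ^ n) 0 1 = u * A 0 1 ∧ (A ^ n) 1 0 = u * A 1 0 ∧
      (A ^ n) 1 1 - (A ^ n) 0 0 = u * (A 1 1 - A 0 0) := by
  induction n with
  | zero => exact ⟨0, by simp, by simp, by simp⟩
  | succ n ih =>
    obtain ⟨u, h1, h2, h3⟩ := ih
    refine ⟨u * A 0 0 + (A ^ n) 1 1, ?_, ?_, ?_⟩ <;>
      simp only [pow_succ, Matrix.mul_apply, Fin.sum_univ_two]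
    · linear_combination A 1 1 * h1 - A 0 1 * h3
    · linear_combination A 0 0 * h2
    · linear_combination A 0 1 * h2 - A 1 0 * h1 + A 0 0 * h3

lemma exists_fixQuad_pow (A : Matrix (Fin 2) (Fin 2) ℝ) (n : ℕ) :
    ∃ u : ℝ, (A ^ n) 1 0 = u * A 1 0 ∧ ∀ x, fixQuad (A ^ n) x = u * fixQuad A x := by
  obtain ⟨u, h1, h2, h3⟩ := exists_pow_proportional A n
  refine ⟨u, h2, fun x => ?_⟩
  simp only [fixQuad, h1, h2, h3]
  ring

end Sends

section NormalForm

variable {p : ℕ}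

/-- A matrix of the form `± X P Y` with `P` a block word and `X, Y ∈ {1, T}`. -/
def HasNormalForm (p : ℕ) (M : Matrix (Fin 2) (Fin 2) ℝ) : Prop :=
  ∃ σ : ℝ, (σ = 1 ∨ σ = -1) ∧ ∃ X, (X = 1 ∨ X = Tmat) ∧ ∃ Y, (Y = 1 ∨ Y = Tmat) ∧
    ∃ w, Admissible p w ∧ M = σ • (X * blockWord p w * Y)

lemma HasNormalForm.neg {M : Matrix (Fin 2) (Fin 2) ℝ} (h : HasNormalForm p M) :
    HasNormalForm p (-M) := by
  obtain ⟨σ, hσ, X, hX, Y, hY, w, hw, rfl⟩ := h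
  exact ⟨-σ, by rcases hσ with rfl | rfl <;> simp, X, hX, Y, hY, w, hw, by simp⟩

lemma HasNormalForm.mul_Tmat {M : Matrix (Fin 2) (Fin 2) ℝ} (h : HasNormalForm p M) :
    HasNormalForm p (M * Tmat) := by
  obtain ⟨σ, hσ, X, hX, Y, hY, w, hw, rfl⟩ := h
  rcases hY with rfl | rfl
  · exact ⟨σ, hσ, X, hX, Tmat, Or.inr rfl, w, hw, by simp⟩
  · refine ⟨-σ, by rcases hσ with rfl | rfl <;> simp, X, hX, 1, Or.inl rfl, w, hw, ?_⟩
    rw [Matrix.smul_mul, Matrix.mul_assoc, Tmat_mul_self]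
    simp

lemma block_mul_block_cases (hp : 3 ≤ p) {k j : ℤ} (hk : 1 ≤ k ∧ k < p) (hj : 1 ≤ j ∧ j < p) :
    (∃ i : ℤ, (1 ≤ i ∧ i < p) ∧ (block p k * Tmat * block p j = block p i ∨
      block p k * Tmat * block p j = -block p i)) ∨
      block p k * Tmat * block p j = Tmat := by
  rw [block_mul_block hp]
  rcases lt_trichotomy (k + j) p with h | h | h
  · exact Or.inl ⟨k + j, by lia, Or.inl rfl⟩
  · right; rw [h, block_period hp]
  · refine Or.inl ⟨k + j - p, by lia, Or.inr ?_⟩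
    rw [← block_add_period hp, sub_add_cancel]

lemma HasNormalForm.mul_block (hp : 3 ≤ p) {M : Matrix (Fin 2) (Fin 2) ℝ}
    (h : HasNormalForm p M) {j : ℤ} (hj : 1 ≤ j ∧ j < p) : HasNormalForm p (M * block p j) := by
  obtain ⟨σ, hσ, X, hX, Y, hY, w, hw, rfl⟩ := h
  rcases hY with rfl | rfl
  · refine ⟨σ, hσ, X, hX, 1, Or.inl rfl, w ++ [j], ?_, by simp [Matrix.mul_assoc]⟩
    exact admissible_append.2 ⟨hw, admissible_cons.2 ⟨hj, Admissible.nil⟩⟩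
  · have hσ' : -σ = 1 ∨ -σ = -1 := by rcases hσ with rfl | rfl <;> simp
    rcases List.eq_nil_or_concat w with rfl | ⟨v, k, rfl⟩
    · have hj' : Admissible p [j] := admissible_cons.2 ⟨hj, Admissible.nil⟩
      rcases hX with rfl | rfl
      · exact ⟨σ, hσ, Tmat, Or.inr rfl, 1, Or.inl rfl, [j], hj', by simp⟩
      · refine ⟨-σ, hσ', 1, Or.inl rfl, 1, Or.inl rfl, [j], hj', ?_⟩
        simp [Tmat_mul_self]
    · rw [List.concat_eq_append, admissible_append, admissible_cons] at hw
      have key : σ • (X * blockWord p (v.concat k) * Tmat) * block p j =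
          σ • (X * blockWord p v * (block p k * Tmat * block p j)) := by
        simp [Matrix.mul_assoc]
      rw [key]
      rcases block_mul_block_cases hp hw.2.1 hj with ⟨i, hi, h | h⟩ | h
      · refine ⟨σ, hσ, X, hX, 1, Or.inl rfl, v ++ [i], ?_, by simp [h, Matrix.mul_assoc]⟩
        exact admissible_append.2 ⟨hw.1, admissible_cons.2 ⟨hi, Admissible.nil⟩⟩
      · refine ⟨-σ, hσ', X, hX, 1, Or.inl rfl, v ++ [i], ?_, by simp [h, Matrix.mul_assoc]⟩
        exact admissible_append.2 ⟨hw.1, admissible_cons.2 ⟨hi, Admissible.nil⟩⟩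
      · exact ⟨σ, hσ, X, hX, Tmat, Or.inr rfl, v, hw.1, by rw [h]⟩

lemma hasNormalForm_of_mem (hp : 3 ≤ p) {M : Matrix.SpecialLinearGroup (Fin 2) ℝ}
    (hM : M ∈ heckeGroup (heckeLambda p)) : HasNormalForm p M.1 := by
  have hS : (Sgen (heckeLambda p)).1 = block p 1 := (block_one hp).symm
  have hT : Tgen.1 = Tmat := rfl
  refine Subgroup.closure_induction_right (p := fun M _ => HasNormalForm p M.1)
    ?_ ?_ ?_ hM
  · exact ⟨1, Or.inl rfl, 1, Or.inl rfl, 1, Or.inl rfl, [], Admissible.nil, by simp⟩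
  · rintro x _ y (rfl | rfl) h
    · rw [Matrix.SpecialLinearGroup.coe_mul, hS]
      exact h.mul_block hp (by lia)
    · rw [Matrix.SpecialLinearGroup.coe_mul, hT]
      exact h.mul_Tmat
  · rintro x _ y (rfl | rfl) h
    · have h1 : ((Sgen (heckeLambda p))⁻¹).1 = -(Tmat * block p (p - 1) * Tmat) := by
        rw [Matrix.SpecialLinearGroup.coe_inv, ← block_transpose hp, block_one hp, Sgen,
          Matrix.adjugate_fin_two_of]
        ext i j
        fin_cases i <;> fin_cases j <;>
          simp [Smat, Tmat_mul_apply_zero,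
            Tmat_mul_apply_one, mul_Tmat_apply_zero, mul_Tmat_apply_one]
      rw [Matrix.SpecialLinearGroup.coe_mul, h1, Matrix.mul_neg, ← Matrix.mul_assoc,
        ← Matrix.mul_assoc]
      exact ((h.mul_Tmat.mul_block hp (by lia)).mul_Tmat).neg
    · have h1 : (Tgen⁻¹).1 = -Tmat := by
        rw [Matrix.SpecialLinearGroup.coe_inv, Tgen, Matrix.adjugate_fin_two_of]
        simp [Tmat]
      rw [Matrix.SpecialLinearGroup.coe_mul, h1, Matrix.mul_neg]
      exact h.mul_Tmat.neg

/-- Multiplying by a sufficiently long block word absorbs a letter `T`. -/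
lemma blockWord_mul_Tmat_mul (hp : 3 ≤ p) (v : List ℤ) :
    ∀ w, Admissible p v → Admissible p w → v.length ≤ w.length →
      ∃ σ : ℝ, (σ = 1 ∨ σ = -1) ∧ ∃ X, (X = 1 ∨ X = Tmat) ∧ ∃ q, Admissible p q ∧
        blockWord p v * Tmat * blockWord p w = σ • (X * blockWord p q) := by
  induction v using List.reverseRecOn with
  | nil => exact fun w _ hw _ => ⟨1, Or.inl rfl, Tmat, Or.inr rfl, w, hw, by simp⟩
  | append_singleton v k ih =>
    intro w hv hw hlen
    rcases w with _ | ⟨j, w⟩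
    · simp at hlen
    rw [admissible_append, admissible_cons] at hv
    rw [admissible_cons] at hw
    have key : blockWord p (v ++ [k]) * Tmat * blockWord p (j :: w) =
        blockWord p v * (block p k * Tmat * block p j) * blockWord p w := by
      simp [Matrix.mul_assoc]
    rw [key]
    rcases block_mul_block_cases hp hv.2.1 hw.1 with ⟨i, hi, h | h⟩ | h
    · refine ⟨1, Or.inl rfl, 1, Or.inl rfl, v ++ i :: w, ?_, by simp [h, Matrix.mul_assoc]⟩
      exact admissible_append.2 ⟨hv.1, admissible_cons.2 ⟨hi, hw.2⟩⟩
    · refine ⟨-1, Or.inr rfl, 1, Or.inl rfl, v ++ i :: w, ?_, by simp [h, Matrix.mul_assoc]⟩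
      exact admissible_append.2 ⟨hv.1, admissible_cons.2 ⟨hi, hw.2⟩⟩
    · rw [h]
      exact ih w hv.1 hw.2 (by simpa using hlen)

lemma HasNormalForm.exists_mul_blockWord (hp : 3 ≤ p) {M : Matrix (Fin 2) (Fin 2) ℝ}
    (h : HasNormalForm p M) : ∃ N : ℕ, ∀ w, Admissible p w → N ≤ w.length →
      ∃ σ : ℝ, (σ = 1 ∨ σ = -1) ∧ ∃ X, (X = 1 ∨ X = Tmat) ∧ ∃ q, Admissible p q ∧
        M * blockWord p w = σ • (X * blockWord p q) := by
  obtain ⟨σ, hσ, X, hX, Y, hY, v, hv, rfl⟩ := h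
  refine ⟨v.length, fun w hw hlen => ?_⟩
  rcases hY with rfl | rfl
  · exact ⟨σ, hσ, X, hX, v ++ w, admissible_append.2 ⟨hv, hw⟩, by simp [Matrix.mul_assoc]⟩
  · obtain ⟨τ, hτ, Z, hZ, q, hq, h⟩ := blockWord_mul_Tmat_mul hp v w hv hw hlen
    have key : σ • (X * blockWord p v * Tmat) * blockWord p w =
        (σ * τ) • (X * Z * blockWord p q) := by
      rw [Matrix.smul_mul, Matrix.mul_assoc X, Matrix.mul_assoc X, h, mul_smul]
      simp [Matrix.mul_assoc]
    have hs : ∀ s : ℝ, s = 1 ∨ s = -1 → -s = 1 ∨ -s = -1 := by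
      rintro s (rfl | rfl) <;> simp
    have hστ : σ * τ = 1 ∨ σ * τ = -1 := by
      rcases hσ with rfl | rfl <;> rcases hτ with rfl | rfl <;> simp
    rw [key]
    rcases hX with rfl | rfl
    · exact ⟨σ * τ, hστ, Z, hZ, q, hq, by simp⟩
    · rcases hZ with rfl | rfl
      · exact ⟨σ * τ, hστ, Tmat, Or.inr rfl, q, hq, by simp⟩
      · exact ⟨-(σ * τ), hs _ hστ, 1, Or.inl rfl, q, hq, by simp [Tmat_mul_self]⟩

/-- Two block words of the same length whose images of positive numbers agree are equal. -/
lemma blockWord_injective (hp : 3 ≤ p) (v : List ℤ) :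
    ∀ w, Admissible p v → Admissible p w → v.length = w.length →
      ∀ x y z : ℝ, 0 < x → 0 < y → Sends (blockWord p v) x z → Sends (blockWord p w) y z →
        v = w := by
  have aux : ∀ k j : ℤ, k < j → 1 ≤ k → j < p → ∀ x y z : ℝ, 0 < x → 0 < y →
      Sends (block p k) x z → Sends (block p j) y z → False := by
    intro k j hkj hk hj x y z hx hy h1 h2
    rw [show j = k + (j - k) by ring, ← block_mul_block hp, Matrix.mul_assoc] at h2
    obtain ⟨t, ht, h3⟩ := (DiagPos.block hp (k := j - k) (by lia) (by lia)).exists_sends hy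
    have h4 := h3.mul (sends_Tmat ht.ne')
    have h5 := h4.of_mul h2
    have h6 := h1.left_unique (det_block hp k) h5
    have : -1 / t < 0 := div_neg_of_neg_of_pos (by norm_num) ht
    linarith
  induction v with
  | nil =>
    intro w _ _ hlen
    exact fun _ _ _ _ _ _ _ => (List.length_eq_zero_iff.1 hlen.symm).symm
  | cons k v ih =>
    intro w hv hw hlen x y z hx hy h1 h2
    rcases w with _ | ⟨j, w⟩
    · simp at hlen
    rw [admissible_cons] at hv hw
    rw [blockWord_cons] at h1 h2
    obtain ⟨x', hx', h3⟩ := (DiagPos.blockWord hp hv.2).exists_sends hx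
    obtain ⟨y', hy', h4⟩ := (DiagPos.blockWord hp hw.2).exists_sends hy
    have h5 := h3.of_mul h1
    have h6 := h4.of_mul h2
    rcases lt_trichotomy k j with h | rfl | h
    · exact (aux k j h hv.1.1 hw.1.2 x' y' z hx' hy' h5 h6).elim
    · have h7 := h5.left_unique (det_block hp k) h6
      subst h7
      rw [ih w hv.2 hw.2 (by simpa using hlen) x y x' hx hy h3 h4]
    · exact (aux j k h hw.1.1 hv.1.2 y' x' z hy' hx' h6 h5).elim

lemma Sends.pow {A : Matrix (Fin 2) (Fin 2) ℝ} {x : ℝ} (h : Sends A x x) (n : ℕ) :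
    Sends (A ^ n) x x := by
  induction n with
  | zero => simp [Sends]
  | succ n ih => rw [pow_succ]; exact h.mul ih

end NormalForm

section Fixed

variable {p : ℕ} {A : Matrix (Fin 2) (Fin 2) ℝ} {x y z : ℝ}

lemma eq_or_eq_of_fixQuad (hA : A 1 0 ≠ 0) (hxy : y ≠ x) (hx : fixQuad A x = 0)
    (hy : fixQuad A y = 0) (hz : fixQuad A z = 0) : z = x ∨ z = y := by
  unfold fixQuad at hx hy hz
  have h : A 1 0 * (y - x) * ((z - x) * (z - y)) = 0 := by
    linear_combination (y - x) * hz + (z - y) * hx + (x - z) * hy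
  rcases mul_eq_zero.1 h with h | h
  · exact (mul_ne_zero hA (sub_ne_zero.2 hxy) h).elim
  · exact (mul_eq_zero.1 h).imp sub_eq_zero.1 sub_eq_zero.1

lemma lower_left_ne_zero (hdet : A.det = 1) (htr : 2 < |A 0 0 + A 1 1|) (hxy : y ≠ x)
    (hx : fixQuad A x = 0) (hy : fixQuad A y = 0) : A 1 0 ≠ 0 := by
  intro h
  unfold fixQuad at hx hy
  rw [h] at hx hy
  rw [Matrix.det_fin_two, h] at hdet
  have h1 : (A 1 1 - A 0 0) * (y - x) = 0 := by linear_combination hy - hx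
  have h2 := (mul_eq_zero.1 h1).resolve_right (sub_ne_zero.2 hxy)
  have h3 : (A 0 0 + A 1 1) ^ 2 = 4 := by linear_combination 4 * hdet + (A 1 1 - A 0 0) * h2
  have h4 := sq_abs (A 0 0 + A 1 1)
  nlinarith

/-- The point `0` is not fixed by a hyperbolic matrix in normal form. -/
lemma HasNormalForm.abs_trace_le (hp : 3 ≤ p) (h : HasNormalForm p A) (h0 : A 0 1 = 0) :
    |A 0 0 + A 1 1| ≤ 2 := by
  obtain ⟨σ, hσ, X, hX, Y, hY, w, hw, rfl⟩ := h
  have hσ0 : σ ≠ 0 := by rcases hσ with rfl | rfl <;> norm_num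
  have hσ1 : |σ| = 1 := by rcases hσ with rfl | rfl <;> simp
  obtain ⟨a, b, c, d⟩ := DiagPos.blockWord hp hw
  have hdet := det_blockWord hp w
  rw [Matrix.det_fin_two] at hdet
  have key : blockWord p w 0 1 * blockWord p w 1 0 = 0 →
      blockWord p w 0 0 = 1 ∧ blockWord p w 1 1 = 1 := by
    intro h0
    constructor <;> nlinarith
  rcases hX with rfl | rfl <;> rcases hY with rfl | rfl <;>
    simp [Tmat_mul_apply_zero, Tmat_mul_apply_one, mul_Tmat_apply_zero, mul_Tmat_apply_one,
      hσ0] at h0 ⊢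
  · obtain ⟨h1, h2⟩ := key (by rw [h0]; ring)
    rw [h1, h2, ← mul_add, abs_mul, hσ1]
    norm_num
  · linarith
  · linarith
  · obtain ⟨h1, h2⟩ := key (by rw [h0]; ring)
    rw [h1, h2, ← neg_add, abs_neg, ← mul_add, abs_mul, hσ1]
    norm_num

/-- A matrix in normal form with fixed points of opposite signs shares them with a block word. -/
lemma HasNormalForm.exists_blockWord_fixQuad (hp : 3 ≤ p) (h : HasNormalForm p A)
    (hA : A 1 0 ≠ 0) (hx : 0 < x) (hy : y < 0) (hx0 : fixQuad A x = 0) (hy0 : fixQuad A y = 0) :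
    ∃ w, Admissible p w ∧ w ≠ [] ∧ fixQuad (blockWord p w) x = 0 := by
  obtain ⟨σ, hσ, X, hX, Y, hY, w, hw, rfl⟩ := h
  have hσ0 : σ ≠ 0 := by rcases hσ with rfl | rfl <;> norm_num
  rw [fixQuad_smul, mul_eq_zero, or_iff_right hσ0] at hx0 hy0
  rw [Matrix.smul_apply, smul_ne_zero_iff] at hA
  replace hA := hA.2
  obtain ⟨a, b, c, d⟩ := DiagPos.blockWord hp hw
  rcases hX with rfl | rfl <;> rcases hY with rfl | rfl
  · simp only [one_mul, mul_one] at hx0 hA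
    refine ⟨w, hw, ?_, hx0⟩
    rintro rfl
    simp at hA
  · exfalso
    simp [fixQuad, mul_Tmat_apply_zero, mul_Tmat_apply_one] at hy0
    nlinarith [mul_nonneg (neg_nonneg.2 hy.le) b, mul_nonneg (neg_nonneg.2 hy.le) c, sq_nonneg y,
      mul_nonneg (sub_nonneg.2 d) (sq_nonneg y)]
  · exfalso
    simp [fixQuad, Tmat_mul_apply_zero, Tmat_mul_apply_one] at hx0
    nlinarith [mul_nonneg hx.le b, mul_nonneg hx.le c, sq_nonneg x,
      mul_nonneg (sub_nonneg.2 a) (sq_nonneg x)]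
  · obtain ⟨v, hv, h⟩ := exists_blockWord_transpose hp hw
    refine ⟨v, hv, ?_, ?_⟩
    · rintro rfl
      have h1 := congrFun (congrFun h 1) 0
      simp at h1
      simp [Tmat_mul_apply_one, mul_Tmat_apply_zero, h1] at hA
    · rw [← h]
      simp [fixQuad, Tmat_mul_apply_zero, Tmat_mul_apply_one, mul_Tmat_apply_zero,
        mul_Tmat_apply_one] at hx0 ⊢
      linear_combination hx0

/-- Block words with a common positive fixed point share the other fixed point too. -/
lemma blockWord_fixQuad_of_common (hp : 3 ≤ p) {v w : List ℤ} (hv : Admissible p v)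
    (hw : Admissible p w) (hne : w ≠ []) (hx : 0 < x) (h1 : Sends (blockWord p v) x x)
    (h2 : Sends (blockWord p w) x x) (hy : Sends (blockWord p w) y y) :
    fixQuad (blockWord p v) y = 0 := by
  rcases eq_or_ne v [] with rfl | hv0
  · simp [fixQuad]
  have heq : (List.replicate w.length v).flatten = (List.replicate v.length w).flatten := by
    refine blockWord_injective hp _ _ (hv.flatten_replicate _) (hw.flatten_replicate _)
      (by simp [mul_comm]) x x x hx hx ?_ ?_
    · rw [blockWord_flatten_replicate]
      exact h1.pow _
    · rw [blockWord_flatten_replicate]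
      exact h2.pow _
  have hpow : blockWord p v ^ w.length = blockWord p w ^ v.length := by
    rw [← blockWord_flatten_replicate, heq, blockWord_flatten_replicate]
  have hy' := (hy.pow v.length).fixQuad_eq_zero
  rw [← hpow] at hy'
  obtain ⟨u, hu, hq⟩ := exists_fixQuad_pow (blockWord p v) w.length
  have hpos : 0 < (blockWord p v ^ w.length) 1 0 := by
    rw [← blockWord_flatten_replicate]
    refine (blockWord_pos_of_fixQuad hp (hv.flatten_replicate _) ?_ hx ?_).2
    · intro h
      have := congrArg List.length h
      simp at this
      tauto
    · rw [blockWord_flatten_replicate]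
      exact (h1.pow _).fixQuad_eq_zero
  have hu0 : u ≠ 0 := by
    rintro rfl
    rw [hu, zero_mul] at hpos
    exact lt_irrefl _ hpos
  rw [hq] at hy'
  exact (mul_eq_zero.1 hy').resolve_left hu0

/-- If the positive number `x` is fixed by a block word, then every hyperbolic matrix in normal
form fixing `x` has its other fixed point negative. -/
lemma HasNormalForm.neg_of_fixQuad (hp : 3 ≤ p) (h : HasNormalForm p A) (hdet : A.det = 1)
    (htr : 2 < |A 0 0 + A 1 1|) (hyx : y ≠ x) (hx0 : fixQuad A x = 0) (hy0 : fixQuad A y = 0)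
    {v : List ℤ} (hv : Admissible p v) (hne : v ≠ []) (hx : 0 < x)
    (hvx : fixQuad (blockWord p v) x = 0) : y < 0 := by
  have hA := lower_left_ne_zero hdet htr hyx hx0 hy0
  obtain ⟨N, hN⟩ := h.exists_mul_blockWord hp
  obtain ⟨w, hw, hwne, hlen, hwx⟩ : ∃ w, Admissible p w ∧ w ≠ [] ∧ N ≤ w.length ∧
      Sends (blockWord p w) x x := by
    refine ⟨_, hv.flatten_replicate (N + 1), ?_, ?_, ?_⟩
    · simpa [List.replicate_succ] using fun h => (hne h).elim
    · have := List.length_pos_iff.2 hne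
      simp only [List.length_flatten, List.map_replicate, List.sum_replicate, smul_eq_mul]
      nlinarith
    · rw [blockWord_flatten_replicate]
      exact (sends_of_fixQuad (det_blockWord hp v) hvx).pow _
  obtain ⟨σ, hσ, X, hX, q, hq, hMw⟩ := hN w hw hlen
  have hσ0 : σ ≠ 0 := by rcases hσ with rfl | rfl <;> norm_num
  have h1 : Sends (A * blockWord p w) x x := hwx.mul (sends_of_fixQuad hdet hx0)
  rw [hMw, sends_smul hσ0] at h1
  rcases hX with rfl | rfl
  swap
  · exact ((DiagPos.blockWord hp hq).not_sends_Tmat_mul hx hx h1).elim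
  rw [one_mul] at h1 hMw
  obtain ⟨hb, hc⟩ := blockWord_pos_of_fixQuad hp hw hwne hx hwx.fixQuad_eq_zero
  obtain ⟨t, ht0, ht⟩ : ∃ t < 0, blockWord p w 1 0 * x * t = -(blockWord p w 0 1) :=
    ⟨-(blockWord p w 0 1) / (blockWord p w 1 0 * x),
      div_neg_of_neg_of_pos (neg_neg_of_pos hb) (by positivity), by field_simp⟩
  have hwt : Sends (blockWord p w) t t := by
    apply sends_of_fixQuad (det_blockWord hp w)
    have h2 := hwx.fixQuad_eq_zero
    unfold fixQuad at h2 ⊢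
    apply mul_left_cancel₀ (mul_pos (mul_pos hc hx) hx).ne'
    linear_combination (x * (blockWord p w 1 0 * t + blockWord p w 1 1 - blockWord p w 0 0)
      - blockWord p w 0 1) * ht - blockWord p w 0 1 * h2
  have hqt := sends_of_fixQuad (det_blockWord hp q)
    (blockWord_fixQuad_of_common hp hq hw hwne hx h1 hwx hwt)
  rw [← sends_smul hσ0, ← hMw] at hqt
  have hAt := (hwt.of_mul hqt).fixQuad_eq_zero
  rcases eq_or_eq_of_fixQuad hA hyx hx0 hy0 hAt with h | h <;> linarith

end Fixed

section Dynamics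

variable {p : ℕ} {x y t : ℝ}

lemma cq_add (l x : ℝ) (m n : ℕ) : cq l x (m + n) = cq l (cq l x n) m := by
  induction m with
  | zero => simp [cq]
  | succ m ih => rw [Nat.add_right_comm, cq, cq, ih]

lemma cq_one_of_add {l g : ℝ} (hg : 0 ≤ g) (hgl : g < l) (j : ℕ) :
    cq l (g + j * l) 1 = 1 / (l - g) := by
  have hl : 0 < l := hg.trans_lt hgl
  have h : ⌊(g + j * l) / l⌋ = (j : ℤ) := by
    rw [Int.floor_eq_iff, le_div_iff₀ hl, div_lt_iff₀ hl]
    push_cast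
    constructor <;> linarith
  rw [cq, cq, h]
  congr 1
  push_cast
  ring

lemma sends_block_one (hp : 3 ≤ p) (x : ℝ) : Sends (block p 1) x (x + heckeLambda p) := by
  rw [block_one hp]
  simp [Sends, Smat]

lemma sends_replicate_one (hp : 3 ≤ p) (n : ℕ) (x : ℝ) :
    Sends (blockWord p (List.replicate n 1)) x (x + n * heckeLambda p) := by
  rw [blockWord_replicate_one hp]
  simp [Sends, SmatZ]

lemma mul_sub_of_sends_block (hp : 3 ≤ p) {k : ℤ} {z : ℝ} (hx : Sends (block p k) y x)
    (hz : Sends (block p (k - 1)) y z) : z * (heckeLambda p - x) = 1 := by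
  obtain ⟨h1, -⟩ := hx
  obtain ⟨h2, h3⟩ := hz
  have r1 := sinRatio_rec hp k
  have r2 := sinRatio_rec hp (k - 1)
  simp only [sub_add_cancel] at r2
  simp [block] at h1 h2 h3
  apply mul_right_cancel₀ h3
  linear_combination (-heckeLambda p + x) * h2 + h1 - y * r2 - r1

lemma cq_of_sends_block (hp : 3 ≤ p) (hy : 0 < y) (n : ℕ) (hn : (n : ℤ) + 2 < p) :
    ∀ (j : ℕ) (x : ℝ), Sends (block p (n + 2)) y x →
      cq (heckeLambda p) (x + j * heckeLambda p) (n + 1) = y + heckeLambda p := by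
  induction n with
  | zero =>
    intro j x h
    have hx := (DiagPos.block hp (k := 2) (by lia) (by lia)).pos_of_sends hy (by simpa using h)
    have h1 := mul_sub_of_sends_block hp (k := 2) (by simpa using h)
      (by simpa using sends_block_one hp y)
    have hz : 0 < y + heckeLambda p := by linarith [one_le_heckeLambda hp]
    have hxl : 0 < heckeLambda p - x := by
      by_contra! hc
      nlinarith
    rw [cq_one_of_add hx.le (by linarith), ← h1]
    field_simp
  | succ n ih =>
    intro j x h
    push_cast at hn h
    have hx := (DiagPos.block hp (k := n + 1 + 2) (by lia) (by lia)).pos_of_sends hy h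
    obtain ⟨z, hz, hz'⟩ :=
      (DiagPos.block hp (k := n + 2) (by lia) (by lia)).exists_sends hy
    have h1 := mul_sub_of_sends_block hp h
      (by rwa [show (n : ℤ) + 1 + 2 - 1 = n + 2 by ring])
    have hxl : 0 < heckeLambda p - x := by
      by_contra! hc
      nlinarith
    have h2 : 1 / (heckeLambda p - x) = z + (0 : ℕ) * heckeLambda p := by
      rw [← h1]; field_simp; simp
    rw [cq_add, cq_one_of_add hx.le (by linarith), h2]
    exact ih (by lia) 0 z hz'

lemma exists_cq_of_sends_blockWord (hp : 3 ≤ p) {k : ℤ} (hk : 2 ≤ k) (hkp : k < p) (ht : 0 < t)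
    (q : List ℤ) (hq : Admissible p q) :
    ∀ (j : ℕ) (x : ℝ), Sends (blockWord p q * block p k) t x →
      ∃ m, 1 ≤ m ∧ cq (heckeLambda p) (x + j * heckeLambda p) m = t + heckeLambda p := by
  have hkpos := DiagPos.block hp (k := k) (by lia) hkp
  induction q with
  | nil =>
    intro j x h
    obtain ⟨n, rfl⟩ : ∃ n : ℕ, k = n + 2 := ⟨(k - 2).toNat, by lia⟩
    exact ⟨n + 1, by lia, cq_of_sends_block hp ht n hkp j x (by simpa using h)⟩
  | cons a q ih =>
    intro j x h
    rw [admissible_cons] at hq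
    obtain ⟨y, hy, hty⟩ := ((DiagPos.blockWord hp hq.2).mul hkpos).exists_sends ht
    rw [blockWord_cons, Matrix.mul_assoc] at h
    have hyx := hty.of_mul h
    rcases eq_or_lt_of_le hq.1.1 with rfl | ha
    · obtain ⟨m, hm, h1⟩ := ih hq.2 (j + 1) y hty
      refine ⟨m, hm, ?_⟩
      rw [← h1, hyx.right_unique (sends_block_one hp y)]
      congr 1
      push_cast
      ring
    · obtain ⟨n, rfl⟩ : ∃ n : ℕ, a = n + 2 := ⟨(a - 2).toNat, by lia⟩
      obtain ⟨m, hm, h1⟩ := ih hq.2 1 y hty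
      refine ⟨m + (n + 1), by lia, ?_⟩
      rw [cq_add, cq_of_sends_block hp hy n hq.1.2 j x hyx, ← h1]
      simp

lemma exists_eq_append_replicate (hp : 3 ≤ p) (w : List ℤ) (hw : Admissible p w)
    (hc : blockWord p w 1 0 ≠ 0) :
    ∃ (q : List ℤ) (k : ℤ) (n : ℕ), Admissible p q ∧ 2 ≤ k ∧ k < p ∧ w = q ++ k :: List.replicate n 1 := by
  induction w using List.reverseRecOn with
  | nil => simp at hc
  | append_singleton w a ih =>
    rw [admissible_append, admissible_cons] at hw
    rcases eq_or_lt_of_le hw.2.1.1 with rfl | ha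
    · obtain ⟨q, k, n, hq, hk, hkp, rfl⟩ := ih hw.1 (by
        simpa [block_one hp, Smat, Matrix.mul_apply, Fin.sum_univ_two] using hc)
      exact ⟨q, k, n + 1, hq, hk, hkp, by simp [List.replicate_succ']⟩
    · exact ⟨w, a, 0, hw.1, ha, hw.2.1.2, rfl⟩

lemma cq_succ_bounds {l : ℝ} (hl : 0 < l) (x : ℝ) (n : ℕ) :
    0 < cq l x (n + 1) ∧ 1 ≤ cq l x (n + 1) * l ∧
      cq l x n = (⌊cq l x n / l⌋ + 1) * l - 1 / cq l x (n + 1) := by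
  have h1 := Int.floor_le (cq l x n / l)
  have h2 := Int.lt_floor_add_one (cq l x n / l)
  rw [le_div_iff₀ hl] at h1
  rw [div_lt_iff₀ hl] at h2
  have h3 : 0 < ((⌊cq l x n / l⌋ : ℝ) + 1) * l - cq l x n := by linarith
  refine ⟨by rw [cq]; positivity, ?_, by rw [cq, one_div_one_div]; ring⟩
  rw [cq, div_mul_eq_mul_div, one_mul, le_div_iff₀ h3]
  linarith

lemma sends_replicate_mul_Tmat (hp : 3 ≤ p) (hx : x ≠ 0) (n : ℕ) :
    Sends (blockWord p (List.replicate n 1) * (block p 1 * Tmat)) x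
      ((n + 1) * heckeLambda p - 1 / x) := by
  have h := ((sends_Tmat hx).mul (sends_block_one hp _)).mul (sends_replicate_one hp n _)
  convert h using 1
  ring

/-- The tail of the continued fraction of `x` is sent to `x - i λ` by a block word ending in a
block `W_k T`, where `k` is controlled by the size of the tail. -/
lemma exists_sends_cq (hp : 3 ≤ p) {i : ℤ} (hi : i ≤ ⌊x / heckeLambda p⌋) (n : ℕ) :
    ∃ (q : List ℤ) (k : ℤ), Admissible p q ∧ 1 ≤ k ∧ k + 1 < p ∧
      sinRatio p k ≤ cq (heckeLambda p) x (n + 1) * sinRatio p (k + 1) ∧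
      Sends (blockWord p q * (block p k * Tmat)) (cq (heckeLambda p) x (n + 1))
        (x - i * heckeLambda p) := by
  have hl : 0 < heckeLambda p := zero_lt_one.trans_le (one_le_heckeLambda hp)
  have hs2 : sinRatio p (1 + 1) = heckeLambda p := sinRatio_two hp
  induction n with
  | zero =>
    obtain ⟨h1, h2, h3⟩ := cq_succ_bounds hl x 0
    obtain ⟨e, he⟩ : ∃ e : ℕ, ⌊x / heckeLambda p⌋ = i + e :=
      ⟨(⌊x / heckeLambda p⌋ - i).toNat, by lia⟩
    refine ⟨List.replicate e 1, 1, Admissible.replicate_one hp e, le_rfl, by lia, ?_, ?_⟩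
    · rwa [sinRatio_one hp, hs2]
    · convert sends_replicate_mul_Tmat hp h1.ne' e using 1
      rw [cq, he] at h3
      push_cast at h3
      linear_combination h3
  | succ n ih =>
    obtain ⟨q, k, hq, hk, hkp, hsk, hsend⟩ := ih
    obtain ⟨hpos, -, -⟩ := cq_succ_bounds hl x n
    obtain ⟨h1, h2, h3⟩ := cq_succ_bounds hl x (n + 1)
    set b := cq (heckeLambda p) x (n + 1)
    set b' := cq (heckeLambda p) x (n + 1 + 1)
    have hfl : 0 ≤ ⌊b / heckeLambda p⌋ := Int.floor_nonneg.2 (by positivity)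
    obtain ⟨e, he⟩ := Int.eq_ofNat_of_zero_le hfl
    rw [he] at h3
    have h4 := sends_replicate_mul_Tmat hp h1.ne' e
    rw [show ((e : ℝ) + 1) * heckeLambda p - 1 / b' = b by rw [h3]; push_cast; rfl] at h4
    have h5 := h4.mul hsend
    rcases e with _ | e
    · have h6 : b' * (heckeLambda p - b) = 1 := by
        rw [h3]; field_simp; simp
      have hbl : b < heckeLambda p := by
        by_contra! hc
        nlinarith
      have hkp' : k + 1 + 1 < p := by
        by_contra! hc
        obtain rfl : k = p - 2 := by lia
        rw [show (p : ℤ) - 2 + 1 = p - 1 by ring, sinRatio_period_sub hp,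
          sinRatio_period_sub hp, sinRatio_one hp, sinRatio_two hp] at hsk
        linarith
      refine ⟨q, k + 1, hq, by lia, hkp', ?_, ?_⟩
      · have hrec := sinRatio_rec hp (k + 1)
        rw [add_sub_cancel_right] at hrec
        rw [hrec]
        have h7 : sinRatio p (k + 1) =
          b' * (heckeLambda p * sinRatio p (k + 1) - b * sinRatio p (k + 1)) := by
            linear_combination -sinRatio p (k + 1) * h6
        rw [h7]
        nlinarith
      · convert h5 using 1
        simp only [List.replicate_zero, blockWord_nil, one_mul, Matrix.mul_assoc]
        rw [← block_mul_block hp k 1]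
        simp only [Matrix.mul_assoc]
    · refine ⟨q ++ (k + 1) :: List.replicate e 1, 1, ?_, le_rfl, by lia, ?_, ?_⟩
      · exact admissible_append.2
          ⟨hq, admissible_cons.2 ⟨by lia, Admissible.replicate_one hp e⟩⟩
      · rwa [sinRatio_one hp, hs2]
      · convert h5 using 1
        rw [List.replicate_succ, blockWord_cons, blockWord_append, blockWord_cons,
          ← block_mul_block hp k 1]
        simp only [Matrix.mul_assoc]

lemma IsHypFixedPt.add {l : ℝ} (h : IsHypFixedPt l x) : IsHypFixedPt l (x + l) := by
  obtain ⟨M, hM, htr, hfix⟩ := h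
  have hS : Sgen l ∈ heckeGroup l := Subgroup.subset_closure (by simp)
  refine ⟨Sgen l * M * (Sgen l)⁻¹, mul_mem (mul_mem hS hM) (inv_mem hS), ?_, ?_⟩
  · rw [Matrix.SpecialLinearGroup.coe_mul, Matrix.SpecialLinearGroup.coe_mul,
      Matrix.SpecialLinearGroup.coe_inv]
    convert htr using 2
    simp [Sgen, Matrix.adjugate_fin_two_of, Matrix.mul_apply, Fin.sum_univ_two, Matrix.vecMul,
      dotProduct]
    ring
  · unfold fixesQuad at hfix ⊢
    rw [Matrix.SpecialLinearGroup.coe_mul, Matrix.SpecialLinearGroup.coe_mul,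
      Matrix.SpecialLinearGroup.coe_inv]
    simp [Sgen, Matrix.adjugate_fin_two_of, Matrix.mul_apply, Fin.sum_univ_two, Matrix.vecMul,
      dotProduct]
    linear_combination hfix

lemma IsHypFixedPt.add_nat_mul {l : ℝ} (h : IsHypFixedPt l x) (n : ℕ) :
    IsHypFixedPt l (x + n * l) := by
  induction n with
  | zero => simpa using h
  | succ n ih =>
    convert ih.add using 1
    push_cast
    ring

end Dynamics

/-- a hyperbolic fixed point `α` with Hecke conjugate `α'` is
`G_p`-simple (`α' < 0 < α`) iff `α = β - iλ` for some `G_p`-reduced `β` and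
some integer `i` with `1 ≤ i ≤ ⌊β/λ⌋`. -/
theorem hecke_simple_characterization (p : ℕ) (hp : 3 ≤ p) (α α' : ℝ)
    (hpair : IsHypPair (heckeLambda p) α α') :
    (α' < 0 ∧ 0 < α) ↔
      ∃ β : ℝ, ∃ i : ℤ, GpReduced (heckeLambda p) β ∧ 1 ≤ i ∧
        i ≤ ⌊β / heckeLambda p⌋ ∧ α = β - i * heckeLambda p := by
  set l := heckeLambda p with hl
  obtain ⟨M, hM, htr, hα, hα', hne⟩ := hpair
  have hl0 : 0 < l := zero_lt_one.trans_le (one_le_heckeLambda hp)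
  have hnf := hasNormalForm_of_mem hp hM
  have hdet : M.1.det = 1 := M.2
  constructor
  · rintro ⟨hneg, hpos⟩
    have hc := lower_left_ne_zero hdet htr hne hα hα'
    obtain ⟨w, hw, hw0, hfix⟩ := hnf.exists_blockWord_fixQuad hp hc hpos hneg hα hα'
    obtain ⟨q, k, n, hq, hk, hkp, rfl⟩ := exists_eq_append_replicate hp w hw
      (blockWord_pos_of_fixQuad hp hw hw0 hpos hfix).2.ne'
    have hsend := sends_of_fixQuad (det_blockWord hp _) hfix
    rw [blockWord_append, blockWord_cons, ← Matrix.mul_assoc] at hsend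
    obtain ⟨m, hm, hcq⟩ := exists_cq_of_sends_blockWord hp hk hkp
      (by positivity : 0 < α + n * l) q hq (n + 1) α
      ((sends_replicate_one hp n α).of_mul hsend)
    refine ⟨α + (n + 1 : ℕ) * l, (n + 1 : ℕ),
      ⟨IsHypFixedPt.add_nat_mul ⟨M, hM, htr, hα⟩ _, m, hm, ?_⟩, by lia, ?_, by simp⟩
    · rw [hcq]
      push_cast
      ring
    · rw [Int.le_floor, le_div_iff₀ hl0]
      push_cast
      linarith
  · rintro ⟨β, i, ⟨-, m, hm, hcq⟩, hi, hifl, rfl⟩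
    have hnonneg : 0 ≤ β - i * l := by
      rw [Int.le_floor, le_div_iff₀ hl0] at hifl
      linarith
    have hpos : 0 < β - i * l := by
      refine hnonneg.lt_of_ne fun h0 => ?_
      have := hnf.abs_trace_le hp (by rw [← h0] at hα; simpa [fixesQuad] using hα)
      linarith
    refine ⟨?_, hpos⟩
    obtain ⟨n, rfl⟩ := Nat.exists_eq_add_of_le' hm
    obtain ⟨q, k, hq, hk, hkp, -, hsend⟩ := exists_sends_cq hp hifl n
    rw [← hl, hcq] at hsend
    obtain ⟨e, rfl⟩ : ∃ e : ℕ, i = e + 1 := ⟨(i - 1).toNat, by lia⟩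
    have h1 := (sends_replicate_one hp e (β - ((e + 1 : ℤ) : ℝ) * l)).mul (sends_block_one hp _)
    rw [← hl, show β - ((e + 1 : ℤ) : ℝ) * l + e * l + l = β by push_cast; ring] at h1
    have h2 := h1.mul hsend
    refine hnf.neg_of_fixQuad hp hdet htr hne hα hα' (v := q ++ (k + 1) :: List.replicate e 1)
      ?_ (by simp) hpos ?_
    · exact admissible_append.2 ⟨hq, admissible_cons.2 ⟨by lia, Admissible.replicate_one hp e⟩⟩
    · rw [blockWord_append, blockWord_cons, ← block_mul_block hp k 1]
      simpa only [Matrix.mul_assoc] using h2.fixQuad_eq_zero
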